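/- Let l ≥ 1 and e ≥ 2 be integers and let ξ : ℤ^l → ℤ^l be the bijection ξ(s_1,…,s_l) = (s_l − e, s_1, …, s_{l−1}) (with inverse ξ^{−1}(s_1,…,s_l) = (s_2,…,s_l, s_1 + e)). Then for every s ∈ S_e = {s ∈ ℤ^l : 0 ≤ s_c − s_{c'} < e whenever c' < c} there exists k ∈ ℤ such that ξ^k(s) ∈ D_e = {s ∈ ℤ^l : 0 ≤ s_1 ≤ … ≤ s_l < e}. -/

import Mathlib

namespace FockCrystal

/-- `s ∈ S_e`: `0 ≤ s_c − s_{c'} < e` whenever `c' < c`. -/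
def InSe (l e : ℕ) (s : Fin (l + 1) → ℤ) : Prop :=
  ∀ c' c : Fin (l + 1), c' < c → 0 ≤ s c - s c' ∧ s c - s c' < (e : ℤ)

/-- `s ∈ D_e`: `0 ≤ s_1 ≤ … ≤ s_l < e`. -/
def InDe (l e : ℕ) (s : Fin (l + 1) → ℤ) : Prop :=
  (∀ c, 0 ≤ s c ∧ s c < (e : ℤ)) ∧ Monotone s

/-- The cyclage bijection `ξ(s_1,…,s_l) = (s_l − e, s_1, …, s_{l−1})` on multicharges,
as a permutation of `ℤ^l` (first subtract `e` from the last entry, then rotate). -/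
def xiPerm (l e : ℕ) : Equiv.Perm (Fin (l + 1) → ℤ) :=
  (Equiv.mk
    (fun s c => s c - if c = Fin.last l then (e : ℤ) else 0)
    (fun s c => s c + if c = Fin.last l then (e : ℤ) else 0)
    (fun s => by funext c; simp)
    (fun s => by funext c; simp)).trans
  (Equiv.arrowCongr (finRotate (l + 1)) (Equiv.refl ℤ))

theorem xiPerm_zero (l e : ℕ) (s : Fin (l + 1) → ℤ) :
    xiPerm l e s 0 = s (Fin.last l) - e := by
  have h : (finRotate (l + 1)).symm 0 = Fin.last l := by
    rw [Equiv.symm_apply_eq, finRotate_last]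
  simp [xiPerm, Equiv.arrowCongr, h]

theorem xiPerm_succ (l e : ℕ) (s : Fin (l + 1) → ℤ) (i : Fin l) :
    xiPerm l e s i.succ = s i.castSucc := by
  have h : (finRotate (l + 1)).symm i.succ = i.castSucc := by
    rw [Equiv.symm_apply_eq, finRotate_apply, Fin.coeSucc_eq_succ]
  simp [xiPerm, Equiv.arrowCongr, h, (Fin.castSucc_lt_last i).ne]

theorem xiPerm_apply (l e : ℕ) (s : Fin (l + 1) → ℤ) (c : Fin (l + 1)) :
    xiPerm l e s c = s ((finRotate (l + 1)).symm c) - if c = 0 then (e : ℤ) else 0 := by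
  have h : (finRotate (l + 1)).symm c = Fin.last l ↔ c = 0 := by
    rw [Equiv.symm_apply_eq, finRotate_last]
  change _ - (if _ = Fin.last l then (e : ℤ) else 0) = _
  simp only [h]

/-- The bi-infinite sequence extending `s`, whose length-`(l + 1)` windows form the
`xiPerm`-orbit of `s`. -/
def unrolled (l e : ℕ) (s : Fin (l + 1) → ℤ) (n : ℤ) : ℤ :=
  (xiPerm l e ^ (-n)) s 0

theorem xiPerm_zpow_neg (l e : ℕ) (s : Fin (l + 1) → ℤ) (n : ℤ) :
    (xiPerm l e ^ (-n)) s = xiPerm l e ((xiPerm l e ^ (-(n + 1))) s) := by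
  rw [← Equiv.Perm.mul_apply, ← zpow_one_add]
  congr 2
  ring

theorem xiPerm_zpow_neg_apply (l e : ℕ) (s : Fin (l + 1) → ℤ) (c : Fin (l + 1)) (n : ℤ) :
    (xiPerm l e ^ (-n)) s c = unrolled l e s (n + (c : ℕ)) := by
  induction c using Fin.induction generalizing n with
  | zero => simp [unrolled]
  | succ i ih =>
    rw [xiPerm_zpow_neg, xiPerm_succ, ih]
    congr 1
    simp only [Fin.val_castSucc, Fin.val_succ]
    push_cast
    ring

theorem unrolled_add_period (l e : ℕ) (s : Fin (l + 1) → ℤ) (n : ℤ) :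
    unrolled l e s (n + (l + 1 : ℕ)) = unrolled l e s n + e := by
  have h : unrolled l e s n = unrolled l e s (n + 1 + (Fin.last l : ℕ)) - e := by
    rw [← xiPerm_zpow_neg_apply, ← xiPerm_zero, ← xiPerm_zpow_neg]
    rfl
  rw [h]
  simp only [Fin.val_last, sub_add_cancel]
  congr 1
  push_cast
  ring

theorem unrolled_coe (l e : ℕ) (s : Fin (l + 1) → ℤ) (c : Fin (l + 1)) :
    unrolled l e s (c : ℕ) = s c := by
  simpa using (xiPerm_zpow_neg_apply l e s c 0).symm

section Quasiperiodic

variable {t : ℤ → ℤ} {L e : ℕ}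

theorem quasiperiodic_add_mul (hper : ∀ n, t (n + L) = t n + e) (n q : ℤ) :
    t (n + L * q) = t n + e * q := by
  induction q using Int.induction_on with
  | zero => simp
  | succ i ih =>
    rw [show n + L * ((i : ℤ) + 1) = n + L * i + L by ring, hper, ih]
    ring
  | pred i ih =>
    have h := hper (n + L * (-(i : ℤ) - 1))
    rw [show n + L * (-(i : ℤ) - 1) + L = n + L * -i by ring, ih] at h
    linarith

theorem quasiperiodic_monotone (hL : 0 < L) (hper : ∀ n, t (n + L) = t n + e)
    (hstep : ∀ n : ℕ, n < L → t n ≤ t (n + 1)) : Monotone t := by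
  refine monotone_int_of_le_succ fun n => ?_
  have hL' : (0 : ℤ) < L := by exact_mod_cast hL
  obtain ⟨r, hr⟩ := Int.eq_ofNat_of_zero_le (Int.emod_nonneg n hL'.ne')
  have hrL : r < L := by
    have := Int.emod_lt_of_pos n hL'
    omega
  have hn : n = r + L * (n / L) := by rw [← hr, Int.emod_add_mul_ediv]
  rw [hn, add_right_comm, quasiperiodic_add_mul hper, quasiperiodic_add_mul hper]
  linarith [hstep r hrL]

/-- A nondecreasing quasiperiodic integer sequence crosses zero. -/
theorem quasiperiodic_exists_crossing (he : 0 < e) (hper : ∀ n, t (n + L) = t n + e)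
    (hmono : Monotone t) : ∃ n, 0 ≤ t n ∧ t (n - 1) < 0 := by
  have he' : (1 : ℤ) ≤ e := by exact_mod_cast he
  have hval (q : ℤ) : t (L * q) = t 0 + e * q := by
    simpa using quasiperiodic_add_mul hper 0 q
  have hneg : t (L * (-|t 0| - 1)) < 0 := by
    rw [hval]
    nlinarith [le_abs_self (t 0), abs_nonneg (t 0)]
  have hnonneg : 0 ≤ t (L * |t 0|) := by
    rw [hval]
    nlinarith [neg_abs_le (t 0), abs_nonneg (t 0)]
  obtain ⟨n, hn, hleast⟩ := Int.exists_least_of_bdd (P := fun n => 0 ≤ t n)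
    ⟨_, fun z hz => (hmono.reflect_lt (hneg.trans_le hz)).le⟩ ⟨_, hnonneg⟩
  refine ⟨n, hn, ?_⟩
  by_contra! h
  have := hleast _ h
  omega

end Quasiperiodic

theorem unrolled_monotone {l e : ℕ} (he : 0 < e) {s : Fin (l + 1) → ℤ} (hs : InSe l e s) :
    Monotone (unrolled l e s) := by
  refine quasiperiodic_monotone l.succ_pos (unrolled_add_period l e s) fun n hn => ?_
  rcases (Nat.lt_succ_iff.mp hn).lt_or_eq with h | rfl
  · have h0 := unrolled_coe l e s ⟨n, hn⟩
    have h1 := unrolled_coe l e s ⟨n + 1, Nat.succ_lt_succ h⟩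
    have h2 := (hs ⟨n, hn⟩ ⟨n + 1, Nat.succ_lt_succ h⟩ (Fin.mk_lt_mk.mpr n.lt_succ_self)).1
    push_cast at h0 h1
    linarith
  · have h0 := unrolled_coe n e s (Fin.last n)
    have h1 := unrolled_coe n e s 0
    have hp := unrolled_add_period n e s 0
    have hle : s (Fin.last n) ≤ s 0 + e := by
      rcases (Fin.zero_le (Fin.last n)).eq_or_lt with h | h
      · rw [← h]
        omega
      · linarith [(hs _ _ h).2]
    simp only [Fin.val_last, Fin.val_zero, Nat.cast_zero, zero_add] at h0 h1 hp
    push_cast at hp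
    linarith

/-!
STATEMENT 1: ξ is the bijection ξ(s_1,…,s_l) = (s_l − e, s_1, …, s_{l−1}); for every
s ∈ S_e there exists k ∈ ℤ with ξ^k(s) ∈ D_e.  (The first conjunct pins down the
formula for `xiPerm`.)
-/
theorem cyclage_reaches_fundamental_domain (l e : ℕ) (he : 2 ≤ e) :
    (∀ (s : Fin (l + 1) → ℤ) (c : Fin (l + 1)),
        xiPerm l e s c = s ((finRotate (l + 1)).symm c) - if c = 0 then (e : ℤ) else 0) ∧
    ∀ s : Fin (l + 1) → ℤ, InSe l e s → ∃ k : ℤ, InDe l e ((xiPerm l e ^ k) s) := by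
  refine ⟨xiPerm_apply l e, fun s hs => ?_⟩
  have hmono := unrolled_monotone (by omega) hs
  obtain ⟨n, hn, hpred⟩ :=
    quasiperiodic_exists_crossing (by omega) (unrolled_add_period l e s) hmono
  have hend := unrolled_add_period l e s (n - 1)
  refine ⟨-n, fun c => ?_, fun a b hab => ?_⟩
  · rw [xiPerm_zpow_neg_apply]
    have hlo : unrolled l e s n ≤ unrolled l e s (n + (c : ℕ)) := hmono (by omega)
    have hhi : unrolled l e s (n + (c : ℕ)) ≤ unrolled l e s (n - 1 + (l + 1 : ℕ)) :=
      hmono (by omega)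
    constructor <;> linarith
  · rw [xiPerm_zpow_neg_apply, xiPerm_zpow_neg_apply]
    exact hmono (by simpa using hab)

end FockCrystal
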